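/- Let P ⊆ ℝ^d be a simplicial reflexive polytope such that the dual polytope P* has a vertex u with −u ∈ P*. Then |V(P)| ≤ 3d if d is even, and |V(P)| ≤ 3d − 1 if d is odd. Moreover, if d is even, then |V(P)| = 3d holds if and only if P* is unimodularly equivalent to the (d/2)-fold product Z₂ × ⋯ × Z₂, where Z₂ := conv(±(1,0), ±(0,1), ±(1,1)) ⊆ ℝ². -/

import Mathlib

open scoped BigOperators

noncomputable section

/-- The standard dot product on `ℝ^d`. -/
def dotProd {d : ℕ} (x y : Fin d → ℝ) : ℝ := ∑ i, x i * y i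

/-- A point of `ℝ^d` is a lattice point (element of `ℤ^d`) if all coordinates are integers. -/
def IsLatticePoint {d : ℕ} (x : Fin d → ℝ) : Prop := ∀ i, ∃ n : ℤ, x i = (n : ℝ)

/-- A lattice polytope is the convex hull of finitely many lattice points. -/
def IsLatticePolytope {d : ℕ} (P : Set (Fin d → ℝ)) : Prop :=
  ∃ V : Finset (Fin d → ℝ), (∀ v ∈ V, IsLatticePoint v) ∧ P = convexHull ℝ (V : Set (Fin d → ℝ))

/-- The dual polytope `P* = {y | ⟨x,y⟩ ≥ -1 ∀ x ∈ P}`. -/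
def dualPolytope {d : ℕ} (P : Set (Fin d → ℝ)) : Set (Fin d → ℝ) :=
  {y | ∀ x ∈ P, -1 ≤ dotProd x y}

/-- A reflexive polytope: a full-dimensional lattice polytope with `0` in its interior whose
dual polytope is again a lattice polytope. -/
def IsReflexive {d : ℕ} (P : Set (Fin d → ℝ)) : Prop :=
  IsLatticePolytope P ∧ (0 : Fin d → ℝ) ∈ interior P ∧ IsLatticePolytope (dualPolytope P)

/-- A face of `P`: the subset of `P` where some linear functional attains its maximum bound. -/
def IsFace {d : ℕ} (P F : Set (Fin d → ℝ)) : Prop :=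
  ∃ (u : Fin d → ℝ) (c : ℝ), (∀ x ∈ P, dotProd u x ≤ c) ∧ F = {x ∈ P | dotProd u x = c}

/-- A facet of a `d`-dimensional polytope: a nonempty face of dimension `d - 1`. -/
def IsFacet {d : ℕ} (P F : Set (Fin d → ℝ)) : Prop :=
  IsFace P F ∧ F.Nonempty ∧ Module.finrank ℝ (vectorSpan ℝ F) = d - 1

/-- `x ∼ y` : `x` and `y` lie in a common facet of `P`. -/
def SameFacet {d : ℕ} (P : Set (Fin d → ℝ)) (x y : Fin d → ℝ) : Prop :=
  ∃ F, IsFacet P F ∧ x ∈ F ∧ y ∈ F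

/-- The star set of `x`: the union of all facets of `P` containing `x`. -/
def starSet {d : ℕ} (P : Set (Fin d → ℝ)) (x : Fin d → ℝ) : Set (Fin d → ℝ) :=
  {y | SameFacet P x y}

/-- A family of lattice points forming a `ℤ`-basis of the lattice `ℤ^d`. -/
def IsZBasisFamily {d n : ℕ} (s : Fin n → (Fin d → ℝ)) : Prop :=
  LinearIndependent ℝ s ∧ (∀ i, IsLatticePoint (s i)) ∧
    ∀ z : Fin d → ℝ, IsLatticePoint z → ∃ c : Fin n → ℤ, z = ∑ i, (c i : ℝ) • s i

/-- A primitive lattice point: a nonzero lattice point such that no lattice point lies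
strictly between `0` and it. -/
def IsPrimitivePoint {d : ℕ} (x : Fin d → ℝ) : Prop :=
  IsLatticePoint x ∧ x ≠ 0 ∧ ∀ y ∈ openSegment ℝ (0 : Fin d → ℝ) x, ¬ IsLatticePoint y

/-- A Fano polytope: a full-dimensional lattice polytope with `0` in its interior all of whose
vertices are primitive lattice points. -/
def IsFanoPolytope {d : ℕ} (P : Set (Fin d → ℝ)) : Prop :=
  IsLatticePolytope P ∧ (0 : Fin d → ℝ) ∈ interior P ∧
    ∀ v ∈ Set.extremePoints ℝ P, IsPrimitivePoint v

/-- Canonical: the only interior lattice point is the origin. -/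
def IsCanonicalPolytope {d : ℕ} (P : Set (Fin d → ℝ)) : Prop :=
  {x ∈ interior P | IsLatticePoint x} = {0}

/-- Terminal: the only lattice points of `P` are the origin and the vertices. -/
def IsTerminalPolytope {d : ℕ} (P : Set (Fin d → ℝ)) : Prop :=
  {x ∈ P | IsLatticePoint x} = insert (0 : Fin d → ℝ) (Set.extremePoints ℝ P)

/-- Simplicial: every facet has exactly `d` vertices. -/
def IsSimplicial {d : ℕ} (P : Set (Fin d → ℝ)) : Prop :=
  ∀ F, IsFacet P F → (Set.extremePoints ℝ F).ncard = d

/-- Smooth: the vertices of every facet form a `ℤ`-basis of the lattice. -/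
def IsSmoothPolytope {d : ℕ} (P : Set (Fin d → ℝ)) : Prop :=
  ∀ F, IsFacet P F → ∃ s : Fin d → (Fin d → ℝ),
    Set.extremePoints ℝ F = Set.range s ∧ IsZBasisFamily s

/-- Semi-terminal: any two distinct vertices in a common facet are joined by a lattice-point
free segment. -/
def IsSemiTerminal {d : ℕ} (P : Set (Fin d → ℝ)) : Prop :=
  ∀ v ∈ Set.extremePoints ℝ P, ∀ w ∈ Set.extremePoints ℝ P, v ≠ w → SameFacet P v w →
    {x ∈ segment ℝ v w | IsLatticePoint x} = {v, w}

/-- The quotient space `ℝ^d / ℝv`. -/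
abbrev QuotSpace {d : ℕ} (v : Fin d → ℝ) := (Fin d → ℝ) ⧸ (Submodule.span ℝ {v})

/-- The canonical projection `π_v : ℝ^d → ℝ^d/ℝv`. -/
def projAlong {d : ℕ} (v : Fin d → ℝ) : (Fin d → ℝ) →ₗ[ℝ] QuotSpace v :=
  (Submodule.span ℝ {v}).mkQ

/-- The quotient lattice `ℤ^d/ℤv`, regarded as the image of `ℤ^d` in `ℝ^d/ℝv`. -/
def quotLattice {d : ℕ} (v : Fin d → ℝ) : Set (QuotSpace v) :=
  projAlong v '' {x | IsLatticePoint x}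

/-- A primitive point of the quotient lattice `ℤ^d/ℤv`. -/
def QuotPrimitive {d : ℕ} (v : Fin d → ℝ) (q : QuotSpace v) : Prop :=
  q ∈ quotLattice v ∧ q ≠ 0 ∧ ∀ t ∈ openSegment ℝ (0 : QuotSpace v) q, t ∉ quotLattice v

/-- A Fano polytope in the quotient space `ℝ^d/ℝv` with respect to the lattice `ℤ^d/ℤv`. -/
def QuotIsFanoPolytope {d : ℕ} (v : Fin d → ℝ) (Q : Set (QuotSpace v)) : Prop :=
  (∃ V : Finset (QuotSpace v), (∀ q ∈ V, q ∈ quotLattice v) ∧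
      Q = convexHull ℝ (V : Set (QuotSpace v))) ∧
  (0 : QuotSpace v) ∈ interior Q ∧
  ∀ q ∈ Set.extremePoints ℝ Q, QuotPrimitive v q

/-- Unimodular equivalence: a real linear isomorphism mapping lattice onto lattice and one
polytope onto the other. -/
def LatticeEquivTo {d e : ℕ} (P : Set (Fin d → ℝ)) (Q : Set (Fin e → ℝ)) : Prop :=
  ∃ f : (Fin d → ℝ) ≃ₗ[ℝ] (Fin e → ℝ),
    (∀ x, IsLatticePoint x ↔ IsLatticePoint (f x)) ∧ f '' P = Q

/-- The hexagon `Z₂ = conv(±(1,0), ±(0,1), ±(1,1)) ⊆ ℝ²`. -/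
def Z2 : Set (Fin 2 → ℝ) :=
  convexHull ℝ ({![1,0], ![0,1], ![1,1], ![-1,0], ![0,-1], ![-1,-1]} : Set (Fin 2 → ℝ))

/-- The `j`-th coordinate pair of a point of `ℝ^{2m}`. -/
def pairCoords {m : ℕ} (x : Fin (2 * m) → ℝ) (j : Fin m) : Fin 2 → ℝ :=
  fun i => x ⟨2 * (j : ℕ) + (i : ℕ), by have := j.isLt; have := i.isLt; omega⟩

/-- The `m`-fold product `Z₂ × ⋯ × Z₂ ⊆ ℝ^{2m}`. -/
def prodZ2 (m : ℕ) : Set (Fin (2 * m) → ℝ) := {x | ∀ j : Fin m, pairCoords x j ∈ Z2}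

/-- The `j`-th coordinate pair of a point of `ℝ^{2m+1}` (first `2m` coordinates). -/
def pairCoords' {m : ℕ} (x : Fin (2 * m + 1) → ℝ) (j : Fin m) : Fin 2 → ℝ :=
  fun i => x ⟨2 * (j : ℕ) + (i : ℕ), by have := j.isLt; have := i.isLt; omega⟩

/-- The product `[-1,1] × Z₂ × ⋯ × Z₂ ⊆ ℝ^{2m+1}` with `m` hexagon factors. -/
def boxProdZ2 (m : ℕ) : Set (Fin (2 * m + 1) → ℝ) :=
  {x | x ⟨2 * m, by omega⟩ ∈ Set.Icc (-1 : ℝ) 1 ∧ ∀ j : Fin m, pairCoords' x j ∈ Z2}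

open scoped Matrix

theorem dotProd_eq_dotProduct {d : ℕ} (x y : Fin d → ℝ) : dotProd x y = x ⬝ᵥ y := rfl

/-- A lattice polytope has finitely many vertices, all of them lattice points, and is their
convex hull. -/
theorem IsLatticePolytope.exists_vertices {d : ℕ} {P : Set (Fin d → ℝ)}
    (hP : IsLatticePolytope P) :
    ∃ V : Finset (Fin d → ℝ), (V : Set (Fin d → ℝ)) = Set.extremePoints ℝ P ∧
      (∀ v ∈ V, IsLatticePoint v) ∧ P = convexHull ℝ (V : Set (Fin d → ℝ)) := by
  obtain ⟨U, hU, rfl⟩ := hP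
  have hsub : Set.extremePoints ℝ (convexHull ℝ (U : Set (Fin d → ℝ))) ⊆ U :=
    extremePoints_convexHull_subset
  have hfin := U.finite_toSet.subset hsub
  refine ⟨hfin.toFinset, by simp, fun v hv => hU v (hsub (by simpa using hv)), ?_⟩
  have h := closure_convexHull_extremePoints (U.finite_toSet.isCompact_convexHull ℝ)
    (convex_convexHull ℝ (U : Set (Fin d → ℝ)))
  rw [(hfin.isClosed_convexHull ℝ).closure_eq] at h
  rw [hfin.coe_toFinset, h]

theorem convex_dualPolytope {d : ℕ} (P : Set (Fin d → ℝ)) : Convex ℝ (dualPolytope P) := by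
  intro a ha b hb s t hs ht hst x hx
  have h₁ := ha x hx
  have h₂ := hb x hx
  rw [dotProd_eq_dotProduct] at *
  rw [dotProduct_add, dotProduct_smul, dotProduct_smul, smul_eq_mul, smul_eq_mul]
  nlinarith

theorem mem_dualPolytope_convexHull_iff {d : ℕ} {V : Set (Fin d → ℝ)} {y : Fin d → ℝ} :
    y ∈ dualPolytope (convexHull ℝ V) ↔ ∀ v ∈ V, -1 ≤ v ⬝ᵥ y := by
  refine ⟨fun h v hv => h v (subset_convexHull ℝ V hv), fun h => ?_⟩
  have hconv : Convex ℝ {x : Fin d → ℝ | -1 ≤ x ⬝ᵥ y} := by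
    intro a ha b hb s t hs ht hst
    simp only [Set.mem_ofPred_eq, add_dotProduct, smul_dotProduct, smul_eq_mul] at *
    nlinarith
  exact fun x hx => convexHull_min (show V ⊆ {x | -1 ≤ x ⬝ᵥ y} from h) hconv hx

theorem linearMap_apply_eq_dotProduct {d : ℕ} (f : (Fin d → ℝ) →ₗ[ℝ] ℝ) (x : Fin d → ℝ) :
    f x = x ⬝ᵥ fun i => f (Pi.single i 1) := by
  rw [LinearMap.pi_apply_eq_sum_univ f x]
  simp only [dotProduct, smul_eq_mul]
  refine Finset.sum_congr rfl fun i _ => ?_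
  congr 2
  ext j
  simp [Pi.single_apply, eq_comm]

/-- The bipolar theorem for polytopes containing the origin. -/
theorem mem_of_forall_mem_dualPolytope {d : ℕ} {P : Set (Fin d → ℝ)} (hc : Convex ℝ P)
    (hcl : IsClosed P) (h0 : (0 : Fin d → ℝ) ∈ P) {x : Fin d → ℝ}
    (hx : ∀ y ∈ dualPolytope P, -1 ≤ x ⬝ᵥ y) : x ∈ P := by
  by_contra hxP
  obtain ⟨f, c, hfc, hcx⟩ := geometric_hahn_banach_closed_point hc hcl hxP
  have hf (z : Fin d → ℝ) := linearMap_apply_eq_dotProduct f.toLinearMap z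
  set g : Fin d → ℝ := fun i => f.toLinearMap (Pi.single i 1)
  have hc0 : 0 < c := by simpa using hfc 0 h0
  have hmem : (-c⁻¹) • g ∈ dualPolytope P := by
    intro a ha
    have h := hfc a ha
    rw [dotProd_eq_dotProduct, dotProduct_smul, ← hf]
    have h' : c⁻¹ * f a ≤ c⁻¹ * c := by gcongr
    rw [inv_mul_cancel₀ hc0.ne'] at h'
    simp only [smul_eq_mul, ContinuousLinearMap.coe_coe]
    linarith
  have h := hx _ hmem
  rw [dotProduct_smul, ← hf] at h
  have h' : c⁻¹ * c < c⁻¹ * f x := by gcongr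
  rw [inv_mul_cancel₀ hc0.ne'] at h'
  simp only [smul_eq_mul, ContinuousLinearMap.coe_coe] at h
  linarith

open Filter Topology in
/-- Finitely many inequalities `-1 ≤ ⟨v, w⟩` persist under a small move in a direction along
which none of the tight ones decreases. -/
theorem eventually_forall_neg_one_le_dotProduct {d : ℕ} (V : Finset (Fin d → ℝ))
    {w z : Fin d → ℝ} (hw : ∀ v ∈ V, -1 ≤ v ⬝ᵥ w)
    (hz : ∀ v ∈ V, v ⬝ᵥ w = -1 → 0 ≤ v ⬝ᵥ z) :
    ∀ᶠ ε : ℝ in 𝓝[>] 0, ∀ v ∈ V, -1 ≤ v ⬝ᵥ (w + ε • z) := by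
  rw [Filter.eventually_all_finset]
  intro v hv
  simp only [dotProduct_add, dotProduct_smul, smul_eq_mul]
  rcases (hw v hv).eq_or_lt with h | h
  · filter_upwards [self_mem_nhdsWithin] with ε hε
    have := mul_nonneg (le_of_lt hε) (hz v hv h.symm)
    linarith
  · have hlim : Tendsto (fun ε : ℝ => v ⬝ᵥ w + ε * v ⬝ᵥ z) (𝓝[>] 0) (𝓝 (v ⬝ᵥ w)) := by
      have : Tendsto (fun ε : ℝ => v ⬝ᵥ w + ε * v ⬝ᵥ z) (𝓝 0) (𝓝 (v ⬝ᵥ w + 0 * v ⬝ᵥ z)) :=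
        Continuous.tendsto (by fun_prop) 0
      rw [zero_mul, add_zero] at this
      exact this.mono_left nhdsWithin_le_nhds
    filter_upwards [hlim.eventually (lt_mem_nhds h)] with ε hε using hε.le

/-- For `y` in the hull of `W`, some point of `W` satisfies all the inequalities that are tight
at `y` with equality and does at least as well as `y` in a prescribed direction `x`. -/
theorem exists_mem_tight {d : ℕ} {V W : Finset (Fin d → ℝ)}
    (hVW : ∀ v ∈ V, ∀ w ∈ W, -1 ≤ v ⬝ᵥ w) {y : Fin d → ℝ}
    (hy : y ∈ convexHull ℝ (W : Set (Fin d → ℝ))) (x : Fin d → ℝ) :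
    ∃ w ∈ W, x ⬝ᵥ y ≤ x ⬝ᵥ w ∧ ∀ v ∈ V, v ⬝ᵥ y = -1 → v ⬝ᵥ w = -1 := by
  obtain ⟨a, ha0, ha1, rfl⟩ := Finset.mem_convexHull'.1 hy
  have hdot (v : Fin d → ℝ) : v ⬝ᵥ (∑ w ∈ W, a w • w) = ∑ w ∈ W, a w * v ⬝ᵥ w := by
    rw [dotProduct_sum]
    simp only [dotProduct_smul, smul_eq_mul]
  obtain ⟨w, hw, hpos, hle⟩ :
      ∃ w ∈ W, 0 < a w ∧ x ⬝ᵥ (∑ w ∈ W, a w • w) ≤ x ⬝ᵥ w := by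
    by_contra! hcon
    set s := x ⬝ᵥ (∑ w ∈ W, a w • w) with hs
    have hle : ∀ w ∈ W, a w * x ⬝ᵥ w ≤ a w * s := by
      intro w hw
      rcases (ha0 w hw).eq_or_lt with h | h
      · simp [← h]
      · exact mul_le_mul_of_nonneg_left (hcon w hw h).le h.le
    obtain ⟨w, hw, hpos⟩ : ∃ w ∈ W, 0 < a w :=
      Finset.exists_lt_of_sum_lt (by simp [ha1])
    have hlt : ∑ w ∈ W, a w * x ⬝ᵥ w < ∑ w ∈ W, a w * s :=
      Finset.sum_lt_sum hle ⟨w, hw, mul_lt_mul_of_pos_left (hcon w hw hpos) hpos⟩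
    rw [← hdot, ← Finset.sum_mul, ha1, one_mul] at hlt
    exact lt_irrefl _ hlt
  refine ⟨w, hw, hle, fun v hv hvy => ?_⟩
  have hsum : ∑ w ∈ W, a w * (v ⬝ᵥ w + 1) = 0 := by
    simp only [mul_add, mul_one, Finset.sum_add_distrib, ← hdot, ha1, hvy]
    norm_num
  have hzero := (Finset.sum_eq_zero_iff_of_nonneg fun w hw =>
    mul_nonneg (ha0 w hw) (by linarith [hVW v hv w hw])).1 hsum w hw
  rcases mul_eq_zero.1 hzero with h | h
  · exact absurd h hpos.ne'
  · linarith

open Filter Topology in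
/-- The inequalities that are tight at a vertex of the dual polytope span the whole space. -/
theorem span_tight_eq_top {d : ℕ} {V : Finset (Fin d → ℝ)} {w : Fin d → ℝ}
    (hw : w ∈ Set.extremePoints ℝ (dualPolytope (convexHull ℝ (V : Set (Fin d → ℝ))))) :
    Submodule.span ℝ {v | v ∈ V ∧ v ⬝ᵥ w = -1} = ⊤ := by
  by_contra hne
  obtain ⟨f, hf0, hf⟩ := Submodule.exists_le_ker_of_lt_top _ (lt_top_iff_ne_top.2 hne)
  set z : Fin d → ℝ := fun i => f (Pi.single i 1) with hz
  have hfz := linearMap_apply_eq_dotProduct f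
  rw [← hz] at hfz
  have hw' := mem_dualPolytope_convexHull_iff.1 hw.1
  have htight : ∀ v ∈ V, v ⬝ᵥ w = -1 → v ⬝ᵥ z = 0 := by
    intro v hv hvw
    rw [← hfz]
    exact hf (Submodule.subset_span ⟨hv, hvw⟩)
  have h₁ := eventually_forall_neg_one_le_dotProduct V hw' (z := z)
    fun v hv hvw => (htight v hv hvw).ge
  have h₂ := eventually_forall_neg_one_le_dotProduct V hw' (z := -z)
    fun v hv hvw => by rw [dotProduct_neg, htight v hv hvw, neg_zero]
  obtain ⟨ε, ⟨hε₁, hε₂⟩, hε⟩ := ((h₁.and h₂).and self_mem_nhdsWithin).exists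
  have hε : 0 < ε := hε
  have hseg : w ∈ openSegment ℝ (w + ε • z) (w + ε • -z) :=
    ⟨1 / 2, 1 / 2, by norm_num, by norm_num, by norm_num, by ext i; simp; ring⟩
  have heq := hw.2 (mem_dualPolytope_convexHull_iff.2 hε₁)
    (mem_dualPolytope_convexHull_iff.2 hε₂) hseg
  have hz0 : z = 0 := by
    have h : ε • z = 0 := by simpa using heq
    exact (smul_eq_zero.1 h).resolve_left hε.ne'
  exact hf0 (LinearMap.ext fun x => by rw [hfz, hz0]; simp)

open scoped Classical in
/-- In a simplicial polytope with at least one nonzero dimension, exactly `d` vertices lie on the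
facet defined by a vertex of the dual polytope. -/
theorem card_tight_eq {d : ℕ} (hd : 0 < d) {P : Set (Fin d → ℝ)} (hs : IsSimplicial P)
    {V : Finset (Fin d → ℝ)} (hV : (V : Set (Fin d → ℝ)) = Set.extremePoints ℝ P)
    (hPV : P = convexHull ℝ (V : Set (Fin d → ℝ))) {w : Fin d → ℝ}
    (hw : w ∈ Set.extremePoints ℝ (dualPolytope P)) :
    (V.filter fun v => v ⬝ᵥ w = -1).card = d := by
  have hspan : Submodule.span ℝ {v | v ∈ V ∧ v ⬝ᵥ w = -1} = ⊤ :=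
    span_tight_eq_top (by rwa [← hPV])
  have hge : ∀ x ∈ P, -1 ≤ x ⬝ᵥ w := hw.1
  set F : Set (Fin d → ℝ) := {x ∈ P | dotProd (-w) x = 1} with hF
  have hmemF (x : Fin d → ℝ) : x ∈ F ↔ x ∈ P ∧ x ⬝ᵥ w = -1 := by
    rw [hF, Set.mem_sep_iff, dotProd_eq_dotProduct, neg_dotProduct, dotProduct_comm, neg_eq_iff_eq_neg]
  have hVP : ∀ v ∈ V, v ∈ P := fun v hv => extremePoints_subset (hV ▸ hv : v ∈ Set.extremePoints ℝ P)
  have hTF : {v | v ∈ V ∧ v ⬝ᵥ w = -1} ⊆ F := fun v hv => (hmemF v).2 ⟨hVP v hv.1, hv.2⟩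
  have hspanF : Submodule.span ℝ F = ⊤ := top_le_iff.1 (hspan ▸ Submodule.span_mono hTF)
  have : Nonempty (Fin d) := ⟨⟨0, hd⟩⟩
  obtain ⟨p, hp⟩ : F.Nonempty := by
    rw [Set.nonempty_iff_ne_empty]
    rintro h
    rw [h, Submodule.span_empty] at hspanF
    exact bot_ne_top hspanF
  let φ : (Fin d → ℝ) →ₗ[ℝ] ℝ :=
    { toFun := fun x => x ⬝ᵥ w
      map_add' := fun x y => add_dotProduct x y w
      map_smul' := fun c x => smul_dotProduct c x w }
  have hφ (x : Fin d → ℝ) : φ x = x ⬝ᵥ w := rfl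
  have hvsker : vectorSpan ℝ F ≤ LinearMap.ker φ := by
    rw [vectorSpan_def, Submodule.span_le]
    rintro _ ⟨a, ha, b, hb, rfl⟩
    have ha := ((hmemF a).1 ha).2
    have hb := ((hmemF b).1 hb).2
    simp [hφ, sub_dotProduct, ha, hb]
  have hker : LinearMap.ker φ < ⊤ := by
    rw [lt_top_iff_ne_top]
    intro h
    have : φ p = 0 := by rw [← LinearMap.mem_ker, h]; trivial
    rw [hφ, ((hmemF p).1 hp).2] at this
    norm_num at this
  have hupper : Module.finrank ℝ (vectorSpan ℝ F) < d := by
    have := Submodule.finrank_lt (hvsker.trans_lt hker).ne_top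
    simpa using this
  have hlower : d ≤ Module.finrank ℝ (vectorSpan ℝ F) + 1 := by
    have hle : Submodule.span ℝ F ≤ vectorSpan ℝ F ⊔ Submodule.span ℝ {p} := by
      rw [Submodule.span_le]
      intro x hx
      have h₁ : x - p ∈ vectorSpan ℝ F := vsub_mem_vectorSpan ℝ hx hp
      have h₂ := Submodule.add_mem_sup h₁ (Submodule.mem_span_singleton_self (R := ℝ) p)
      simpa using h₂
    rw [hspanF, top_le_iff] at hle
    have h₁ := Submodule.finrank_add_le_finrank_add_finrank (vectorSpan ℝ F) (Submodule.span ℝ {p})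
    have h₂ := finrank_span_le_card (R := ℝ) {p}
    rw [hle] at h₁
    simp only [finrank_top, Module.finrank_fin_fun] at h₁
    simp only [Set.toFinset_singleton, Finset.card_singleton] at h₂
    omega
  have hfacet : IsFacet P F := by
    refine ⟨⟨-w, 1, fun x hx => ?_, rfl⟩, ⟨p, hp⟩, by omega⟩
    rw [dotProd_eq_dotProduct, neg_dotProduct, dotProduct_comm]
    linarith [hge x hx]
  have hext : IsExtreme ℝ P F := by
    refine ⟨fun x hx => ((hmemF x).1 hx).1, fun x hx y hy z hz hzxy => ?_⟩
    obtain ⟨a, b, ha, hb, hab, rfl⟩ := hzxy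
    have hz := ((hmemF _).1 hz).2
    rw [add_dotProduct, smul_dotProduct, smul_dotProduct, smul_eq_mul, smul_eq_mul] at hz
    refine (hmemF x).2 ⟨hx, ?_⟩
    have h₁ := hge x hx
    have h₂ := hge y hy
    have : a * (x ⬝ᵥ w + 1) ≤ 0 := by nlinarith
    nlinarith
  have hcard := hs F hfacet
  rw [hext.extremePoints_eq, ← hV] at hcard
  refine Eq.trans ?_ hcard
  rw [← Set.ncard_coe_finset]
  congr 1
  ext v
  simp only [Finset.coe_filter, Set.mem_ofPred_eq, Set.mem_inter_iff, hmemF, Finset.mem_coe]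
  exact ⟨fun h => ⟨⟨hVP v h.1, h.2⟩, h.1⟩, fun h => ⟨h.2, h.1.2⟩⟩

/-- A spanning set of `d` vectors in `ℝ^d`, enumerated together with its dual basis. -/
theorem exists_dual_bases {d : ℕ} {T : Finset (Fin d → ℝ)} (hcard : T.card = d)
    (hspan : Submodule.span ℝ (T : Set (Fin d → ℝ)) = ⊤) :
    ∃ e z : Fin d → (Fin d → ℝ), Set.range e = T ∧
      (∀ i j, e i ⬝ᵥ z j = if i = j then 1 else 0) ∧
      (∀ x, x = ∑ i, (x ⬝ᵥ z i) • e i) ∧ ∀ y, y = ∑ i, (e i ⬝ᵥ y) • z i := by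
  let g : Fin d ≃ T := (T.equivFinOfCardEq hcard).symm
  let e : Matrix (Fin d) (Fin d) ℝ := fun i => g i
  have hrange : Set.range e = T := by
    have : e = Subtype.val ∘ g := rfl
    rw [this, Set.range_comp, g.surjective.range_eq, Set.image_univ, Subtype.range_coe]
  have hlin : LinearIndependent ℝ e.row := by
    refine linearIndependent_of_top_le_span_of_card_eq_finrank ?_ (by simp)
    change ⊤ ≤ Submodule.span ℝ (Set.range e)
    rw [hrange, hspan]
  have hunit := (Matrix.isUnit_iff_isUnit_det _).1 (Matrix.linearIndependent_rows_iff_isUnit.1 hlin)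
  have h₁ := Matrix.mul_nonsing_inv e hunit
  have h₂ := Matrix.nonsing_inv_mul e hunit
  refine ⟨e, (e⁻¹)ᵀ, hrange, fun i j => ?_, fun x => ?_, fun y => ?_⟩
  · exact (congrFun (congrFun h₁ i) j).trans (by rw [Matrix.one_apply])
  · have h : (x ᵥ* e⁻¹) ᵥ* e = x := by rw [Matrix.vecMul_vecMul, h₂, Matrix.vecMul_one]
    rw [Matrix.vecMul_eq_sum] at h
    exact h.symm
  · have h : e⁻¹ *ᵥ (e *ᵥ y) = y := by rw [Matrix.mulVec_mulVec, h₂, Matrix.one_mulVec]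
    rw [Matrix.mulVec_eq_sum] at h
    simpa [Matrix.mulVec] using h.symm

open scoped Classical in
/-- The vertex sets `V` of a simplicial reflexive polytope and `W` of its dual, seen through their
pairing. -/
structure IsSimplicialReflexivePair {d : ℕ} (V W : Finset (Fin d → ℝ)) : Prop where
  exists_int : ∀ v ∈ V, ∀ w ∈ W, ∃ n : ℤ, v ⬝ᵥ w = n
  ge : ∀ v ∈ V, ∀ w ∈ W, -1 ≤ v ⬝ᵥ w
  card_tight : ∀ w ∈ W, (V.filter fun v => v ⬝ᵥ w = -1).card = d
  span_tight : ∀ w ∈ W, Submodule.span ℝ {v | v ∈ V ∧ v ⬝ᵥ w = -1} = ⊤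
  mem_convexHull : ∀ y, (∀ v ∈ V, -1 ≤ v ⬝ᵥ y) → y ∈ convexHull ℝ (W : Set (Fin d → ℝ))
  zero_notMem : 0 ∉ V

namespace IsSimplicialReflexivePair

variable {d : ℕ} {V W : Finset (Fin d → ℝ)}

/-- Every `w ∈ W` has `d` tight vertices `e i`, forming a basis with dual basis `z i`, and the
neighbours of `w` are the points `w + c i • z i` with positive integers `c i`. -/
theorem exists_frame (H : IsSimplicialReflexivePair V W) {w : Fin d → ℝ} (hw : w ∈ W) :
    ∃ (e z : Fin d → (Fin d → ℝ)) (c : Fin d → ℤ),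
      (∀ v, v ∈ V ∧ v ⬝ᵥ w = -1 ↔ ∃ i, e i = v) ∧
      (∀ i j, e i ⬝ᵥ z j = if i = j then 1 else 0) ∧
      (∀ x, x = ∑ i, (x ⬝ᵥ z i) • e i) ∧
      (∀ y, y = ∑ i, (e i ⬝ᵥ y) • z i) ∧
      ∀ i, 0 < c i ∧ w + (c i : ℝ) • z i ∈ W := by
  classical
  obtain ⟨e, z, hrange, hdual, hx, hy⟩ := exists_dual_bases (H.card_tight w hw)
    (by simpa using H.span_tight w hw)
  have he : ∀ v, v ∈ V ∧ v ⬝ᵥ w = -1 ↔ ∃ i, e i = v := by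
    intro v
    have := Set.ext_iff.1 hrange v
    simpa using this.symm
  have hc : ∀ i, ∃ c : ℤ, 0 < c ∧ w + (c : ℝ) • z i ∈ W := by
    intro i
    have heV (j : Fin d) : e j ∈ V ∧ e j ⬝ᵥ w = -1 := (he _).2 ⟨j, rfl⟩
    have hev := eventually_forall_neg_one_le_dotProduct V (H.ge · · w hw) (z := z i) (by
      intro v hv hvw
      obtain ⟨j, rfl⟩ := (he v).1 ⟨hv, hvw⟩
      rw [hdual]
      split_ifs <;> norm_num)
    obtain ⟨ε, hε, hε0⟩ := (hev.and self_mem_nhdsWithin).exists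
    have hε0 : 0 < ε := hε0
    obtain ⟨w', hw', hle, htight⟩ := exists_mem_tight H.ge (H.mem_convexHull _ hε) (e i)
    have hlevel (j : Fin d) : e j ⬝ᵥ (w + ε • z i) = -1 + ε * if j = i then 1 else 0 := by
      rw [dotProduct_add, dotProduct_smul, hdual, (heV j).2, smul_eq_mul]
    rw [hlevel, if_pos rfl] at hle
    obtain ⟨n, hn⟩ := H.exists_int _ (heV i).1 w' hw'
    refine ⟨n + 1, ?_, ?_⟩
    · have : (-1 : ℝ) < n := by linarith
      have : (-1 : ℤ) < n := by exact_mod_cast this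
      omega
    · convert hw' using 1
      symm
      rw [← sub_eq_iff_eq_add', hy (w' - w), Finset.sum_eq_single i]
      · rw [dotProduct_sub, (heV i).2, hn]
        push_cast
        rw [sub_neg_eq_add]
      · intro j _ hji
        have := htight (e j) (heV j).1 (by rw [hlevel, if_neg hji]; ring)
        rw [dotProduct_sub, this, (heV j).2, sub_self, zero_smul]
      · simp
  choose c hc using hc
  exact ⟨e, z, c, he, hdual, hx, hy, hc⟩

section Frame

variable {w : Fin d → ℝ} {e z : Fin d → (Fin d → ℝ)} {c : Fin d → ℤ}

theorem exists_dotProduct_neg (H : IsSimplicialReflexivePair V W)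
    (he : ∀ v, v ∈ V ∧ v ⬝ᵥ w = -1 ↔ ∃ i, e i = v)
    (hx : ∀ x, x = ∑ i, (x ⬝ᵥ z i) • e i) {v : Fin d → ℝ} (hv : v ∈ V) (hv0 : v ⬝ᵥ w = 0) :
    ∃ i, v ⬝ᵥ z i < 0 := by
  by_contra! hcon
  have hsum : ∑ i, v ⬝ᵥ z i = 0 := by
    have h : v ⬝ᵥ w = ∑ i, -(v ⬝ᵥ z i) := by
      conv_lhs => rw [hx v]
      rw [sum_dotProduct]
      refine Finset.sum_congr rfl fun i _ => ?_
      rw [smul_dotProduct, ((he _).2 ⟨i, rfl⟩).2, smul_eq_mul, mul_neg_one]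
    rw [hv0, Finset.sum_neg_distrib] at h
    linarith
  have hzero := (Finset.sum_eq_zero_iff_of_nonneg fun i _ => hcon i).1 hsum
  have hv' : v = 0 := by
    rw [hx v]
    exact Finset.sum_eq_zero fun i hi => by rw [hzero i hi, zero_smul]
  exact H.zero_notMem (hv' ▸ hv)

/-- A vertex at level `0` with negative `i`-th coordinate is the unique vertex which the `i`-th
neighbouring facet does not share with the base facet. -/
theorem neighbour_eq (H : IsSimplicialReflexivePair V W)
    (he : ∀ v, v ∈ V ∧ v ⬝ᵥ w = -1 ↔ ∃ i, e i = v)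
    (hdual : ∀ i j, e i ⬝ᵥ z j = if i = j then 1 else 0)
    (hc : ∀ i, 0 < c i ∧ w + (c i : ℝ) • z i ∈ W)
    {i : Fin d} {v : Fin d → ℝ} (hv : v ∈ V) (hv0 : v ⬝ᵥ w = 0) (hvi : v ⬝ᵥ z i < 0) :
    (c i : ℝ) * v ⬝ᵥ z i = -1 ∧
      ∀ x ∈ V, x ⬝ᵥ (w + (c i : ℝ) • z i) = -1 → x = v ∨ x ⬝ᵥ w = -1 := by
  classical
  have hlevel (x : Fin d → ℝ) : x ⬝ᵥ (w + (c i : ℝ) • z i) = x ⬝ᵥ w + c i * x ⬝ᵥ z i := by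
    rw [dotProduct_add, dotProduct_smul, smul_eq_mul]
  have hcpos : (0 : ℝ) < c i := by exact_mod_cast (hc i).1
  have hval : (c i : ℝ) * v ⬝ᵥ z i = -1 := by
    obtain ⟨n, hn⟩ := H.exists_int v hv _ (hc i).2
    have hge := H.ge v hv _ (hc i).2
    rw [hlevel, hv0, zero_add] at hn hge
    have hneg := mul_neg_of_pos_of_neg hcpos hvi
    rw [hn] at hge hneg ⊢
    have h₁ : (-1 : ℤ) ≤ n := by exact_mod_cast hge
    have h₂ : n < 0 := by exact_mod_cast hneg
    have : n = -1 := by omega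
    rw [this]
    norm_num
  refine ⟨hval, fun x hxV hxt => ?_⟩
  have hinj : Function.Injective e := by
    intro a b hab
    have h := hdual a b
    rw [hab, hdual b b, if_pos rfl] at h
    by_contra hne
    rw [if_neg hne] at h
    exact one_ne_zero h
  set A : Finset (Fin d → ℝ) := (Finset.univ.erase i).image e with hA
  have hAlevel : ∀ a ∈ A, a ∈ V ∧ a ⬝ᵥ w = -1 := by
    intro a ha
    obtain ⟨j, -, rfl⟩ := Finset.mem_image.1 ha
    exact (he _).2 ⟨j, rfl⟩
  have hvA : v ∉ A := by
    intro h
    have := (hAlevel v h).2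
    rw [hv0] at this
    norm_num at this
  have hcardA : (insert v A).card = d := by
    rw [Finset.card_insert_of_notMem hvA, Finset.card_image_of_injective _ hinj,
      Finset.card_erase_of_mem (Finset.mem_univ i), Finset.card_univ, Fintype.card_fin]
    have := i.pos
    omega
  have hsub : insert v A ⊆ V.filter fun x => x ⬝ᵥ (w + (c i : ℝ) • z i) = -1 := by
    intro a ha
    rw [Finset.mem_filter]
    rcases Finset.mem_insert.1 ha with rfl | ha
    · exact ⟨hv, by rw [hlevel, hv0, hval, zero_add]⟩
    · refine ⟨(hAlevel a ha).1, ?_⟩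
      obtain ⟨j, hj, rfl⟩ := Finset.mem_image.1 ha
      rw [hlevel, (hAlevel _ ha).2, hdual, if_neg (Finset.ne_of_mem_erase hj), mul_zero, add_zero]
  have heq := Finset.eq_of_subset_of_card_le hsub (by
    rw [hcardA]
    exact (H.card_tight _ (hc i).2).le)
  have hmem : x ∈ insert v A := by
    rw [heq]
    exact Finset.mem_filter.2 ⟨hxV, hxt⟩
  rcases Finset.mem_insert.1 hmem with h | h
  · exact Or.inl h
  · exact Or.inr (hAlevel x h).2

theorem eq_of_dotProduct_neg (H : IsSimplicialReflexivePair V W)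
    (he : ∀ v, v ∈ V ∧ v ⬝ᵥ w = -1 ↔ ∃ i, e i = v)
    (hdual : ∀ i j, e i ⬝ᵥ z j = if i = j then 1 else 0)
    (hc : ∀ i, 0 < c i ∧ w + (c i : ℝ) • z i ∈ W)
    {i : Fin d} {v v' : Fin d → ℝ} (hv : v ∈ V) (hv0 : v ⬝ᵥ w = 0) (hvi : v ⬝ᵥ z i < 0)
    (hv' : v' ∈ V) (hv0' : v' ⬝ᵥ w = 0) (hvi' : v' ⬝ᵥ z i < 0) : v' = v := by
  have h := (H.neighbour_eq he hdual hc hv hv0 hvi).2 v' hv' (by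
    rw [dotProduct_add, dotProduct_smul, smul_eq_mul, hv0',
      (H.neighbour_eq he hdual hc hv' hv0' hvi').1, zero_add])
  refine h.resolve_right fun h => ?_
  rw [hv0'] at h
  norm_num at h

end Frame

open scoped Classical in
theorem card_level_zero_le (H : IsSimplicialReflexivePair V W) {w : Fin d → ℝ} (hw : w ∈ W) :
    (V.filter fun v => v ⬝ᵥ w = 0).card ≤ d := by
  obtain ⟨e, z, c, he, hdual, hx, -, hc⟩ := H.exists_frame hw
  have hneg : ∀ v ∈ V.filter fun v => v ⬝ᵥ w = 0, ∃ i, v ⬝ᵥ z i < 0 := by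
    intro v hv
    rw [Finset.mem_filter] at hv
    exact H.exists_dotProduct_neg he hx hv.1 hv.2
  rcases Finset.eq_empty_or_nonempty (V.filter fun v => v ⬝ᵥ w = 0) with hempty | ⟨v₀, hv₀⟩
  · simp [hempty]
  have : Nonempty (Fin d) := (hneg v₀ hv₀).nonempty
  choose! f hf using hneg
  refine (Finset.card_le_card_of_injOn f (t := Finset.univ) (fun _ _ => Finset.mem_univ _)
    fun v hv v' hv' hvv' => ?_).trans (by simp)
  have hfv := hf v hv
  have hfv' := hf v' hv'
  rw [← hvv'] at hfv'
  rw [Finset.mem_coe, Finset.mem_filter] at hv hv'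
  exact H.eq_of_dotProduct_neg he hdual hc hv'.1 hv'.2 hfv' hv.1 hv.2 hfv

theorem card_le_of_le_one (H : IsSimplicialReflexivePair V W) {u : Fin d → ℝ} (hu : u ∈ W)
    (hle : ∀ v ∈ V, v ⬝ᵥ u ≤ 1) : V.card ≤ 3 * d := by
  classical
  obtain ⟨w, hw, -, htight⟩ := exists_mem_tight H.ge (y := -u)
    (H.mem_convexHull _ fun v hv => by
      rw [dotProduct_neg]
      linarith [hle v hv]) 0
  have hsub : V ⊆ (V.filter fun v => v ⬝ᵥ u = -1) ∪ (V.filter fun v => v ⬝ᵥ u = 0) ∪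
      (V.filter fun v => v ⬝ᵥ w = -1) := by
    intro v hv
    simp only [Finset.mem_union, Finset.mem_filter, hv, true_and]
    obtain ⟨n, hn⟩ := H.exists_int v hv u hu
    have h₁ := H.ge v hv u hu
    have h₂ := hle v hv
    rw [hn] at h₁ h₂
    have h₁ : (-1 : ℤ) ≤ n := by exact_mod_cast h₁
    have h₂ : n ≤ 1 := by exact_mod_cast h₂
    obtain rfl | rfl | rfl : n = -1 ∨ n = 0 ∨ n = 1 := by omega
    · exact Or.inl (Or.inl (by simpa using hn))
    · exact Or.inl (Or.inr (by simpa using hn))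
    · exact Or.inr (htight v hv (by rw [dotProduct_neg, hn]; norm_num))
  have h₁ := Finset.card_le_card hsub
  have h₂ := Finset.card_union_le ((V.filter fun v => v ⬝ᵥ u = -1) ∪
    (V.filter fun v => v ⬝ᵥ u = 0)) (V.filter fun v => v ⬝ᵥ w = -1)
  have h₃ := Finset.card_union_le (V.filter fun v => v ⬝ᵥ u = -1) (V.filter fun v => v ⬝ᵥ u = 0)
  have h₄ := H.card_tight u hu
  have h₅ := H.card_tight w hw
  have h₆ := H.card_level_zero_le hu
  omega

open scoped Classical in
/-- With `3 * d` vertices, every facet has all vertices at levels `-1`, `0`, `1`, and exactly `d`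
of them at level `0`. -/
theorem level_of_card_eq (H : IsSimplicialReflexivePair V W) (hcard : V.card = 3 * d)
    {w : Fin d → ℝ} (hw : w ∈ W) :
    (∀ v ∈ V, v ⬝ᵥ w ≤ 1) ∧ (V.filter fun v => v ⬝ᵥ w = 0).card = d := by
  let g (w v : Fin d → ℝ) : ℝ :=
    1 - 2 * (if v ⬝ᵥ w = -1 then 1 else 0) - if v ⬝ᵥ w = 0 then 1 else 0
  have hg : ∀ w ∈ W, ∀ v ∈ V, g w v ≤ v ⬝ᵥ w := by
    intro w hw v hv
    obtain ⟨n, hn⟩ := H.exists_int v hv w hw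
    have h₁ := H.ge v hv w hw
    simp only [g]
    split_ifs with h h' h'
    · linarith
    · linarith
    · linarith
    · rw [hn] at h h' h₁ ⊢
      have : (-1 : ℤ) ≤ n := by exact_mod_cast h₁
      have : n ≠ -1 := by exact_mod_cast h
      have : n ≠ 0 := by exact_mod_cast h'
      have : (1 : ℤ) ≤ n := by omega
      have : (1 : ℝ) ≤ n := by exact_mod_cast this
      linarith
  have hgsum : ∀ w ∈ W, ∑ v ∈ V, g w v = d - (V.filter fun v => v ⬝ᵥ w = 0).card := by
    intro w hw
    simp only [g, Finset.sum_sub_distrib, ← Finset.mul_sum, Finset.sum_boole, H.card_tight w hw,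
      Finset.sum_const, hcard, nsmul_eq_mul]
    push_cast
    ring
  have hnonneg : ∀ w ∈ W, 0 ≤ ∑ v ∈ V, g w v := by
    intro w hw
    have : ((V.filter fun v => v ⬝ᵥ w = 0).card : ℝ) ≤ d := by
      exact_mod_cast H.card_level_zero_le hw
    rw [hgsum w hw]
    linarith
  set S : Fin d → ℝ := ∑ v ∈ V, v with hS
  have hSw (w : Fin d → ℝ) : S ⬝ᵥ w = ∑ v ∈ V, v ⬝ᵥ w := sum_dotProduct _ _ _
  have hS0 : S = 0 := by
    have hev := eventually_forall_neg_one_le_dotProduct V (w := 0) (z := -S)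
      (fun v _ => by simp) (fun v _ h => by simp at h)
    obtain ⟨ε, hε, hε0⟩ := (hev.and self_mem_nhdsWithin).exists
    have hε0 : 0 < ε := hε0
    obtain ⟨w', hw', hle, -⟩ := exists_mem_tight H.ge (H.mem_convexHull _ hε) (-S)
    rw [neg_dotProduct, neg_dotProduct, zero_add, dotProduct_smul, dotProduct_neg, smul_eq_mul,
      hSw w'] at hle
    have h₁ := (hnonneg w' hw').trans (Finset.sum_le_sum (hg w' hw'))
    have h₂ : S ⬝ᵥ S ≤ 0 := by nlinarith
    exact dotProduct_self_eq_zero.1 (le_antisymm h₂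
      (Finset.sum_nonneg fun i _ => mul_self_nonneg _))
  have hzero : ∑ v ∈ V, v ⬝ᵥ w = 0 := by rw [← hSw, hS0, zero_dotProduct]
  have hgzero : ∑ v ∈ V, g w v = 0 :=
    le_antisymm ((Finset.sum_le_sum (hg w hw)).trans hzero.le) (hnonneg w hw)
  refine ⟨fun v hv => ?_, ?_⟩
  · rw [← (Finset.sum_eq_sum_iff_of_le (hg w hw)).1 (hgzero.trans hzero.symm) v hv]
    simp only [g]
    split_ifs <;> norm_num
  · rw [hgsum w hw] at hgzero
    have : ((V.filter fun v => v ⬝ᵥ w = 0).card : ℝ) = d := by linarith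
    exact_mod_cast this

/-- With `3 * d` vertices and `V = -V`, the vertices are `± e i` and `e (σ i) - e i`, where `e` is a
lattice basis and `σ` is a fixed-point-free involution. -/
theorem exists_involution (H : IsSimplicialReflexivePair V W) (hcard : V.card = 3 * d)
    (hneg : ∀ v ∈ V, -v ∈ V) (hWlat : ∀ w ∈ W, IsLatticePoint w) {w : Fin d → ℝ} (hw : w ∈ W) :
    ∃ (e z : Fin d → (Fin d → ℝ)) (σ : Fin d → Fin d),
      (∀ i, σ (σ i) = i) ∧ (∀ i, σ i ≠ i) ∧
      (∀ i j, e i ⬝ᵥ z j = if i = j then 1 else 0) ∧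
      (∀ y, y = ∑ i, (e i ⬝ᵥ y) • z i) ∧ (∀ i, IsLatticePoint (z i)) ∧
      ∀ v, v ∈ V ↔ ∃ i, v = e i ∨ v = -e i ∨ v = e (σ i) - e i := by
  classical
  obtain ⟨e, z, c, he, hdual, hx, hy, hc⟩ := H.exists_frame hw
  obtain ⟨hle, hzero⟩ := H.level_of_card_eq hcard hw
  have hcpos (i : Fin d) : (0 : ℝ) < c i := by exact_mod_cast (hc i).1
  set Z := V.filter fun v => v ⬝ᵥ w = 0 with hZ
  have hZmem {v : Fin d → ℝ} : v ∈ Z ↔ v ∈ V ∧ v ⬝ᵥ w = 0 := by rw [hZ, Finset.mem_filter]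
  have hZneg : ∀ v ∈ Z, ∃ i, v ⬝ᵥ z i < 0 := fun v hv =>
    H.exists_dotProduct_neg he hx (hZmem.1 hv).1 (hZmem.1 hv).2
  have huniq {i : Fin d} {v v' : Fin d → ℝ} (hv : v ∈ Z) (hvi : v ⬝ᵥ z i < 0) (hv' : v' ∈ Z)
      (hvi' : v' ⬝ᵥ z i < 0) : v' = v :=
    H.eq_of_dotProduct_neg he hdual hc (hZmem.1 hv).1 (hZmem.1 hv).2 hvi
      (hZmem.1 hv').1 (hZmem.1 hv').2 hvi'
  choose f hf using fun v : Z => hZneg v v.2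
  have hfinj : Function.Injective f := by
    intro v v' hvv'
    have h := hf v'
    rw [← hvv'] at h
    exact (Subtype.ext (huniq v.2 (hf v) v'.2 h)).symm
  have hfbij : Function.Bijective f :=
    (Fintype.bijective_iff_injective_and_card f).2 ⟨hfinj, by simp [hzero]⟩
  choose m hm using hfbij.2
  have hmneg (i : Fin d) : (m i : Fin d → ℝ) ⬝ᵥ z i < 0 := by
    have := hf (m i)
    rwa [hm] at this
  have hmuniq {i j : Fin d} (h : (m i : Fin d → ℝ) ⬝ᵥ z j < 0) : j = i := by
    have := huniq (m i).2 h (m j).2 (hmneg j)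
    rw [← hm j, Subtype.ext this, hm]
  have hnegm (i : Fin d) : -(m i : Fin d → ℝ) ∈ Z :=
    hZmem.2 ⟨hneg _ (hZmem.1 (m i).2).1, by rw [neg_dotProduct, (hZmem.1 (m i).2).2, neg_zero]⟩
  let σ (i : Fin d) : Fin d := f ⟨-(m i : Fin d → ℝ), hnegm i⟩
  have hmσ (i : Fin d) : (m (σ i) : Fin d → ℝ) = -(m i : Fin d → ℝ) :=
    congrArg Subtype.val (hfinj (hm (σ i)))
  have hσneg (i : Fin d) : 0 < (m i : Fin d → ℝ) ⬝ᵥ z (σ i) := by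
    have := hmneg (σ i)
    rw [hmσ, neg_dotProduct] at this
    linarith
  have hσσ (i : Fin d) : σ (σ i) = i := by
    refine (hmuniq ?_).symm
    rw [hmσ, hmσ, neg_neg]
    exact hmneg i
  have hσne (i : Fin d) : σ i ≠ i := by
    intro h
    have h₁ := hσneg i
    rw [h] at h₁
    linarith [hmneg i]
  have hezV (i : Fin d) : e i ∈ V ∧ e i ⬝ᵥ w = -1 := (he _).2 ⟨i, rfl⟩
  have hc1 (i : Fin d) : c i = 1 := by
    obtain ⟨-, hT⟩ := H.neighbour_eq he hdual hc (hZmem.1 (m i).2).1 (hZmem.1 (m i).2).2 (hmneg i)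
    have hlev : -e i ⬝ᵥ (w + (c i : ℝ) • z i) = ((1 - c i : ℤ) : ℝ) := by
      rw [neg_dotProduct, dotProduct_add, dotProduct_smul, hdual, if_pos rfl, (hezV i).2,
        smul_eq_mul]
      push_cast
      ring
    have h₁ := H.ge _ (hneg _ (hezV i).1) _ (hc i).2
    rw [hlev] at h₁
    have h₁ : (-1 : ℤ) ≤ 1 - c i := by exact_mod_cast h₁
    have h₂ : c i ≠ 2 := by
      intro h
      rw [h] at hlev
      have hlev₁ : -e i ⬝ᵥ w = 1 := by rw [neg_dotProduct, (hezV i).2, neg_neg]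
      rcases hT _ (hneg _ (hezV i).1) (by rw [h, hlev]; norm_num) with h' | h'
      · rw [h', (hZmem.1 (m i).2).2] at hlev₁
        norm_num at hlev₁
      · rw [h'] at hlev₁
        norm_num at hlev₁
    have := (hc i).1
    omega
  have hmval (i : Fin d) : (m i : Fin d → ℝ) ⬝ᵥ z i = -1 := by
    have := (H.neighbour_eq he hdual hc (hZmem.1 (m i).2).1 (hZmem.1 (m i).2).2 (hmneg i)).1
    simpa [hc1] using this
  have hmeq (i : Fin d) : (m i : Fin d → ℝ) = e (σ i) - e i := by
    rw [hx (m i : Fin d → ℝ), ← Finset.add_sum_erase _ _ (Finset.mem_univ i),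
      ← Finset.add_sum_erase _ _ (Finset.mem_erase.2 ⟨hσne i, Finset.mem_univ _⟩),
      Finset.sum_eq_zero, hmval]
    · have h : (m i : Fin d → ℝ) ⬝ᵥ z (σ i) = 1 := by
        have := hmval (σ i)
        rw [hmσ, neg_dotProduct] at this
        linarith
      rw [h, one_smul, neg_one_smul, add_zero, neg_add_eq_sub]
    · intro j hj
      simp only [Finset.mem_erase, Finset.mem_univ, and_true] at hj
      have h₁ : 0 ≤ (m i : Fin d → ℝ) ⬝ᵥ z j := by
        by_contra! h
        exact hj.2 (hmuniq h)
      have h₂ : 0 ≤ -((m i : Fin d → ℝ) ⬝ᵥ z j) := by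
        rw [← neg_dotProduct, ← hmσ]
        by_contra! h
        exact hj.1 (hmuniq h)
      rw [show (m i : Fin d → ℝ) ⬝ᵥ z j = 0 by linarith, zero_smul]
  refine ⟨e, z, σ, hσσ, hσne, hdual, hy, fun i k => ?_, fun v => ⟨fun hv => ?_, ?_⟩⟩
  · obtain ⟨a, ha⟩ := hWlat _ (hc i).2 k
    obtain ⟨b, hb⟩ := hWlat _ hw k
    refine ⟨a - b, ?_⟩
    rw [Pi.add_apply, hc1, hb] at ha
    simp only [Int.cast_one, one_smul] at ha
    push_cast
    linarith
  · obtain ⟨n, hn⟩ := H.exists_int v hv w hw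
    have h₁ := H.ge v hv w hw
    have h₂ := hle v hv
    rw [hn] at h₁ h₂
    have h₁ : (-1 : ℤ) ≤ n := by exact_mod_cast h₁
    have h₂ : n ≤ 1 := by exact_mod_cast h₂
    obtain rfl | rfl | rfl : n = -1 ∨ n = 0 ∨ n = 1 := by omega
    · obtain ⟨i, rfl⟩ := (he v).1 ⟨hv, by simpa using hn⟩
      exact ⟨i, Or.inl rfl⟩
    · have hvZ : v ∈ Z := hZmem.2 ⟨hv, by simpa using hn⟩
      refine ⟨f ⟨v, hvZ⟩, Or.inr (Or.inr ?_)⟩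
      rw [← hmeq]
      exact (congrArg Subtype.val (hfinj (hm (f ⟨v, hvZ⟩)))).symm
    · obtain ⟨i, hi⟩ := (he (-v)).1 ⟨hneg v hv, by rw [neg_dotProduct, hn]; norm_num⟩
      exact ⟨i, Or.inr (Or.inl (by rw [hi, neg_neg]))⟩
  · rintro ⟨i, rfl | rfl | rfl⟩
    · exact (hezV i).1
    · exact hneg _ (hezV i).1
    · rw [← hmeq]
      exact (hZmem.1 (m i).2).1

end IsSimplicialReflexivePair

/-- A fixed-point-free involution on `Fin d` splits `Fin d` into pairs. -/
theorem exists_pairing_of_involution {d : ℕ} {σ : Fin d → Fin d} (hσ : ∀ i, σ (σ i) = i)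
    (hne : ∀ i, σ i ≠ i) :
    ∃ (m : ℕ) (r : Fin m → Fin d), d = 2 * m ∧
      ∀ i, ∃! p : Fin m × Bool, (if p.2 then σ (r p.1) else r p.1) = i := by
  classical
  let R : Finset (Fin d) := Finset.univ.filter fun i => i < σ i
  have hR (i : Fin d) : i ∈ R ↔ i < σ i := by simp [R]
  let g : Fin R.card ≃ R := R.equivFin.symm
  let F (p : Fin R.card × Bool) : Fin d := if p.2 then σ (g p.1) else g p.1
  have hlt (j : Fin R.card) : (g j : Fin d) < σ (g j) := (hR _).1 (g j).2
  have hF : Function.Bijective F := by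
    constructor
    · rintro ⟨j, b⟩ ⟨j', b'⟩ h
      have h₁ := hlt j
      have h₂ := hlt j'
      have hj : ∀ h : (g j : Fin d) = g j', j = j' := fun h => g.injective (Subtype.ext h)
      cases b <;> cases b' <;> simp only [F, Bool.false_eq_true, if_true, if_false] at h
      · rw [hj h]
      · rw [h, hσ] at h₁
        exact absurd h₁ h₂.not_gt
      · rw [← h, hσ] at h₂
        exact absurd h₂ h₁.not_gt
      · rw [hj (by rw [← hσ (g j), h, hσ])]
    · intro i
      rcases lt_or_gt_of_ne (hne i) with h | h
      · exact ⟨(g.symm ⟨σ i, (hR _).2 (by rwa [hσ])⟩, true), by simp [F, hσ]⟩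
      · exact ⟨(g.symm ⟨i, (hR _).2 h⟩, false), by simp [F]⟩
  refine ⟨R.card, fun j => g j, ?_, fun i => hF.existsUnique i⟩
  have := Fintype.card_congr (Equiv.ofBijective F hF)
  simp only [Fintype.card_prod, Fintype.card_fin, Fintype.card_bool] at this
  omega

/-- The hexagon `Z2` in terms of inequalities. -/
theorem mem_Z2_iff (x : Fin 2 → ℝ) :
    x ∈ Z2 ↔ |x 0| ≤ 1 ∧ |x 1| ≤ 1 ∧ |x 1 - x 0| ≤ 1 := by
  constructor
  · have hconv : Convex ℝ {x : Fin 2 → ℝ | |x 0| ≤ 1 ∧ |x 1| ≤ 1 ∧ |x 1 - x 0| ≤ 1} := by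
      intro a ha b hb s t hs ht hst
      simp only [Set.mem_ofPred_eq, Pi.add_apply, Pi.smul_apply, smul_eq_mul, abs_le] at *
      refine ⟨⟨?_, ?_⟩, ⟨?_, ?_⟩, ?_, ?_⟩ <;> nlinarith
    intro hx
    refine convexHull_min ?_ hconv hx
    intro y hy
    simp only [Set.mem_insert_iff, Set.mem_singleton_iff] at hy
    rcases hy with rfl | rfl | rfl | rfl | rfl | rfl <;> norm_num
  · intro h
    simp only [abs_le] at h
    have hc : Convex ℝ Z2 := convex_convexHull ℝ _
    have h₁ : (![1, 0] : Fin 2 → ℝ) ∈ Z2 := subset_convexHull ℝ _ (by simp)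
    have h₂ : (![0, 1] : Fin 2 → ℝ) ∈ Z2 := subset_convexHull ℝ _ (by simp)
    have h₃ : (![1, 1] : Fin 2 → ℝ) ∈ Z2 := subset_convexHull ℝ _ (by simp)
    have h₄ : (![-1, 0] : Fin 2 → ℝ) ∈ Z2 := subset_convexHull ℝ _ (by simp)
    have h₅ : (![0, -1] : Fin 2 → ℝ) ∈ Z2 := subset_convexHull ℝ _ (by simp)
    have h₆ : (![-1, -1] : Fin 2 → ℝ) ∈ Z2 := subset_convexHull ℝ _ (by simp)
    have h₀ : (0 : Fin 2 → ℝ) ∈ Z2 := by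
      have := hc h₁ h₄ (a := 1 / 2) (b := 1 / 2) (by norm_num) (by norm_num) (by norm_num)
      convert this using 1
      ext i
      fin_cases i <;> norm_num
    have key : ∀ (p q : Fin 2 → ℝ), p ∈ Z2 → q ∈ Z2 → ∀ s t : ℝ, 0 ≤ s → 0 ≤ t → s + t ≤ 1 →
        x 0 = s * p 0 + t * q 0 → x 1 = s * p 1 + t * q 1 → x ∈ Z2 := by
      intro p q hp hq s t hs ht hst hx₀ hx₁
      have hsum : ∑ i : Fin 3, ![s, t, 1 - s - t] i • ![p, q, 0] i ∈ Z2 := by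
        refine hc.sum_mem ?_ ?_ ?_
        · intro i _
          fin_cases i <;> simp <;> linarith
        · simp [Fin.sum_univ_three]
        · intro i _
          fin_cases i <;> simp [hp, hq, h₀]
      convert hsum using 1
      ext i
      fin_cases i <;> simp [Fin.sum_univ_three, hx₀, hx₁]
    rcases le_total 0 (x 0) with ha | ha <;> rcases le_total 0 (x 1) with hb | hb
    · rcases le_total (x 0) (x 1) with hab | hab
      · exact key _ _ h₃ h₂ (x 0) (x 1 - x 0) ha (by linarith) (by linarith) (by simp) (by simp)
      · exact key _ _ h₃ h₁ (x 1) (x 0 - x 1) hb (by linarith) (by linarith) (by simp) (by simp)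
    · exact key _ _ h₁ h₅ (x 0) (-x 1) ha (by linarith) (by linarith) (by simp) (by simp)
    · exact key _ _ h₄ h₂ (-x 0) (x 1) (by linarith) hb (by linarith) (by simp) (by simp)
    · rcases le_total (x 0) (x 1) with hab | hab
      · exact key _ _ h₆ h₄ (-x 1) (x 1 - x 0) (by linarith) (by linarith) (by linarith)
          (by simp) (by simp)
      · exact key _ _ h₆ h₅ (-x 0) (x 0 - x 1) (by linarith) (by linarith) (by linarith)
          (by simp) (by simp)

theorem IsLatticePoint.exists_dotProduct_eq {d : ℕ} {x y : Fin d → ℝ} (hx : IsLatticePoint x)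
    (hy : IsLatticePoint y) : ∃ n : ℤ, x ⬝ᵥ y = n := by
  choose a ha using hx
  choose b hb using hy
  refine ⟨∑ i, a i * b i, ?_⟩
  simp only [dotProduct, ha, hb]
  push_cast
  rfl

theorem IsSimplicial.pos {d : ℕ} {P : Set (Fin d → ℝ)} (hs : IsSimplicial P)
    (h0 : (0 : Fin d → ℝ) ∈ P) : 0 < d := by
  rcases Nat.eq_zero_or_pos d with rfl | hd
  · have hfacet : IsFacet P P := by
      refine ⟨⟨0, 0, fun x _ => by simp [dotProd], by simp [dotProd]⟩, ⟨0, h0⟩, ?_⟩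
      exact Module.finrank_zero_of_subsingleton
    have h := hs P hfacet
    rw [Set.extremePoints_eq_self, Set.Subsingleton.eq_singleton_of_mem
      (fun _ _ _ _ => Subsingleton.elim _ _) h0, Set.ncard_singleton] at h
    exact absurd h one_ne_zero
  · exact hd

open Filter Topology in
theorem notMem_extremePoints_of_mem_interior {d : ℕ} (hd : 0 < d) {P : Set (Fin d → ℝ)}
    (h0 : (0 : Fin d → ℝ) ∈ interior P) : (0 : Fin d → ℝ) ∉ Set.extremePoints ℝ P := by
  intro hext
  let x : Fin d → ℝ := fun _ => 1
  have hlim (s : ℝ) : ∀ᶠ ε : ℝ in 𝓝[>] 0, (s * ε) • x ∈ P := by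
    have : Tendsto (fun ε : ℝ => (s * ε) • x) (𝓝 0) (𝓝 ((s * 0) • x)) :=
      Continuous.tendsto (by fun_prop) 0
    rw [mul_zero, zero_smul] at this
    exact (this.mono_left nhdsWithin_le_nhds).eventually (mem_interior_iff_mem_nhds.1 h0)
  obtain ⟨ε, ⟨h₁, h₂⟩, hε⟩ := (((hlim 1).and (hlim (-1))).and self_mem_nhdsWithin).exists
  have hε : 0 < ε := hε
  have h := hext.2 h₁ h₂ ⟨1 / 2, 1 / 2, by norm_num, by norm_num, by norm_num, by ext; simp⟩
  have := congrFun h ⟨0, hd⟩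
  simp only [one_mul, Pi.smul_apply, smul_eq_mul, mul_one, Pi.zero_apply, x] at this
  exact hε.ne' this

theorem IsReflexive.exists_pair {d : ℕ} {P : Set (Fin d → ℝ)} (hP : IsReflexive P)
    (hs : IsSimplicial P) :
    ∃ V W : Finset (Fin d → ℝ), (V : Set (Fin d → ℝ)) = Set.extremePoints ℝ P ∧
      (W : Set (Fin d → ℝ)) = Set.extremePoints ℝ (dualPolytope P) ∧
      P = convexHull ℝ (V : Set (Fin d → ℝ)) ∧
      dualPolytope P = convexHull ℝ (W : Set (Fin d → ℝ)) ∧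
      (∀ v ∈ V, IsLatticePoint v) ∧ (∀ w ∈ W, IsLatticePoint w) ∧
      IsSimplicialReflexivePair V W := by
  obtain ⟨V, hV, hVlat, hPV⟩ := hP.1.exists_vertices
  obtain ⟨W, hW, hWlat, hPW⟩ := hP.2.2.exists_vertices
  have hd := hs.pos (interior_subset hP.2.1)
  have hext : ∀ w ∈ W, w ∈ Set.extremePoints ℝ (dualPolytope P) := fun w hw => hW ▸ hw
  have hdual (y : Fin d → ℝ) : y ∈ dualPolytope P ↔ ∀ v ∈ V, -1 ≤ v ⬝ᵥ y := by
    conv_lhs => rw [hPV]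
    exact mem_dualPolytope_convexHull_iff
  refine ⟨V, W, hV, hW, hPV, hPW, hVlat, hWlat, ?_⟩
  constructor
  · exact fun v hv w hw => (hVlat v hv).exists_dotProduct_eq (hWlat w hw)
  · exact fun v hv w hw => (hdual w).1 (hext w hw).1 v hv
  · exact fun w hw => card_tight_eq hd hs hV hPV (hext w hw)
  · exact fun w hw => span_tight_eq_top (by rw [← hPV]; exact hext w hw)
  · intro y hy
    rw [← hPW]
    exact (hdual y).2 hy
  · intro h
    exact notMem_extremePoints_of_mem_interior hd hP.2.1 (hV ▸ h)

theorem mem_prodZ2_iff {m : ℕ} (x : Fin (2 * m) → ℝ) :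
    x ∈ prodZ2 m ↔ ∀ j, pairCoords x j ∈ Z2 := Iff.rfl

theorem exists_pairCoords_eq {m : ℕ} (k : Fin (2 * m)) :
    ∃ (j : Fin m) (i : Fin 2), ∀ x : Fin (2 * m) → ℝ, pairCoords x j i = x k := by
  refine ⟨⟨k / 2, by omega⟩, ⟨k % 2, by omega⟩, fun x => ?_⟩
  refine congrArg x (Fin.ext ?_)
  simp only
  omega

/-- If the vertices are `± e i` and `e (σ i) - e i` for a lattice basis `e` and a fixed-point-free
involution `σ`, then the dual polytope is a product of hexagons. -/
theorem latticeEquivTo_prodZ2 {m : ℕ} {Q : Set (Fin (2 * m) → ℝ)}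
    {e z : Fin (2 * m) → (Fin (2 * m) → ℝ)} {σ : Fin (2 * m) → Fin (2 * m)}
    (hσ : ∀ i, σ (σ i) = i) (hne : ∀ i, σ i ≠ i)
    (hy : ∀ y, y = ∑ i, (e i ⬝ᵥ y) • z i)
    (he : ∀ i, IsLatticePoint (e i)) (hz : ∀ i, IsLatticePoint (z i))
    (hQ : ∀ y, y ∈ Q ↔ ∀ i, |e i ⬝ᵥ y| ≤ 1 ∧ |e (σ i) ⬝ᵥ y - e i ⬝ᵥ y| ≤ 1) :
    LatticeEquivTo Q (prodZ2 m) := by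
  obtain ⟨m', r, hm, hr⟩ := exists_pairing_of_involution hσ hne
  obtain rfl : m' = m := by omega
  let ρ (j : Fin m') (i : Fin 2) : Fin (2 * m') := if i = 1 then σ (r j) else r j
  let π (k : Fin (2 * m')) : Fin (2 * m') := ρ ⟨k / 2, by omega⟩ ⟨k % 2, by omega⟩
  let g : (Fin (2 * m') → ℝ) →ₗ[ℝ] (Fin (2 * m') → ℝ) :=
    { toFun := fun y k => e (π k) ⬝ᵥ y
      map_add' := fun x y => funext fun k => dotProduct_add _ _ _
      map_smul' := fun c x => funext fun k => dotProduct_smul _ _ _ }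
  have hg (y : Fin (2 * m') → ℝ) (k : Fin (2 * m')) : g y k = e (π k) ⬝ᵥ y := rfl
  have hpair (y : Fin (2 * m') → ℝ) (j : Fin m') (i : Fin 2) :
      pairCoords (g y) j i = e (ρ j i) ⬝ᵥ y := by
    rw [pairCoords, hg]
    congr 2
    have hi := i.isLt
    simp only [π]
    congr 1
    · exact Fin.ext (by simp only; omega)
    · exact Fin.ext (by simp only; omega)
  have hcover (i : Fin (2 * m')) : ∃ j, i = r j ∨ i = σ (r j) := by
    obtain ⟨⟨j, b⟩, h, -⟩ := hr i
    refine ⟨j, ?_⟩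
    cases b
    · exact Or.inl (by simpa using h.symm)
    · exact Or.inr (by simpa using h.symm)
  have hcoord {y : Fin (2 * m') → ℝ} {p : ℝ → Prop} (h : ∀ k, p (g y k)) (i : Fin (2 * m')) :
      p (e i ⬝ᵥ y) := by
    have h' (j : Fin m') (i : Fin 2) : p (e (ρ j i) ⬝ᵥ y) := by
      rw [← hpair]
      exact h _
    obtain ⟨j, rfl | rfl⟩ := hcover i
    · exact h' j 0
    · exact h' j 1
  have hinj : Function.Injective g := by
    rw [injective_iff_map_eq_zero]
    intro y hy0
    have hzero : ∀ i, e i ⬝ᵥ y = 0 := hcoord (p := (· = 0)) fun k => congrFun hy0 k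
    rw [hy y]
    exact Finset.sum_eq_zero fun i _ => by rw [hzero, zero_smul]
  have hmem (y : Fin (2 * m') → ℝ) : y ∈ Q ↔ g y ∈ prodZ2 m' := by
    rw [hQ, mem_prodZ2_iff]
    simp only [mem_Z2_iff, hpair]
    have h₀ (j : Fin m') : ρ j 0 = r j := rfl
    have h₁ (j : Fin m') : ρ j 1 = σ (r j) := rfl
    simp only [h₀, h₁]
    refine ⟨fun h j => ⟨(h _).1, (h _).1, (h _).2⟩, fun h i => ?_⟩
    obtain ⟨j, rfl | rfl⟩ := hcover i
    · exact ⟨(h j).1, (h j).2.2⟩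
    · refine ⟨(h j).2.1, ?_⟩
      rw [hσ, abs_sub_comm]
      exact (h j).2.2
  refine ⟨LinearEquiv.ofInjectiveEndo g hinj, fun x => ⟨fun hx k => ?_, fun hx k => ?_⟩, ?_⟩
  · exact (he _).exists_dotProduct_eq hx
  · choose n hn using hcoord (p := fun t => ∃ n : ℤ, t = n) hx
    choose b hb using fun i => hz i k
    refine ⟨∑ i, n i * b i, ?_⟩
    rw [hy x, Finset.sum_apply]
    simp only [Pi.smul_apply, hn, hb, smul_eq_mul]
    push_cast
    rfl
  · ext x
    constructor
    · rintro ⟨y, hyQ, rfl⟩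
      exact (hmem y).1 hyQ
    · intro hx
      obtain ⟨y, rfl⟩ := (LinearEquiv.ofInjectiveEndo g hinj).surjective x
      exact ⟨y, (hmem y).2 hx, rfl⟩

/-- The point of `ℝ^{2m}` with `j`-th coordinate pair `p` and all other coordinates zero. -/
def pairLift {m : ℕ} (j : Fin m) (p : Fin 2 → ℝ) : Fin (2 * m) → ℝ :=
  fun k => if (k : ℕ) / 2 = j then p ⟨k % 2, Nat.mod_lt _ two_pos⟩ else 0

theorem pairCoords_pairLift {m : ℕ} (j j' : Fin m) (p : Fin 2 → ℝ) :
    pairCoords (pairLift j p) j' = if j' = j then p else 0 := by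
  ext i
  have hi := i.isLt
  have h₁ : (2 * (j' : ℕ) + i) / 2 = j' := by omega
  have h₂ : (2 * (j' : ℕ) + i) % 2 = i := by omega
  simp only [pairCoords, pairLift, h₁, h₂, Fin.val_inj]
  split_ifs <;> rfl

theorem dotProduct_eq_sum_pairCoords {m : ℕ} (x y : Fin (2 * m) → ℝ) :
    x ⬝ᵥ y = ∑ j, pairCoords x j ⬝ᵥ pairCoords y j := by
  simp only [dotProduct]
  rw [← Fintype.sum_prod_type']
  refine (Fintype.sum_equiv (finProdFinEquiv.trans (finCongr (mul_comm m 2))) _ _ ?_).symm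
  rintro ⟨j, i⟩
  simp only [pairCoords]
  have : (finProdFinEquiv.trans (finCongr (mul_comm m 2))) (j, i) =
      ⟨2 * (j : ℕ) + (i : ℕ), by have := j.isLt; have := i.isLt; omega⟩ :=
    Fin.ext (by simp; ring)
  rw [this]

theorem dotProduct_pairLift {m : ℕ} (x : Fin (2 * m) → ℝ) (j : Fin m) (p : Fin 2 → ℝ) :
    x ⬝ᵥ pairLift j p = pairCoords x j ⬝ᵥ p := by
  rw [dotProduct_eq_sum_pairCoords, Finset.sum_eq_single j]
  · rw [pairCoords_pairLift, if_pos rfl]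
  · intro j' _ h
    rw [pairCoords_pairLift, if_neg h, dotProduct_zero]
  · simp

/-- The vertices of the dual of the hexagon `Z2`. -/
def hexagonNormal : Fin 6 → Fin 2 → ℤ :=
  ![![1, 0], ![-1, 0], ![0, 1], ![0, -1], ![-1, 1], ![1, -1]]

theorem hexagonNormal_injective : Function.Injective hexagonNormal := by decide

theorem neg_one_le_hexagonNormal_dotProduct (a : Fin 6) {x : Fin 2 → ℝ} (hx : x ∈ Z2) :
    -1 ≤ (fun i => (hexagonNormal a i : ℝ)) ⬝ᵥ x := by
  rw [mem_Z2_iff] at hx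
  simp only [abs_le] at hx
  fin_cases a <;> simp [hexagonNormal, dotProduct, Fin.sum_univ_two] <;> linarith

theorem exists_hexagonNormal_edge (a : Fin 6) :
    ∃ p ∈ Z2, ∃ q ∈ Z2, (fun i => (hexagonNormal a i : ℝ)) ⬝ᵥ p = -1 ∧
      (fun i => (hexagonNormal a i : ℝ)) ⬝ᵥ q = -1 ∧ p 0 * q 1 - p 1 * q 0 ≠ 0 := by
  have key (p q : Fin 2 → ℝ) (h : p ∈ Z2 ∧ q ∈ Z2 ∧
      (fun i => (hexagonNormal a i : ℝ)) ⬝ᵥ p = -1 ∧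
      (fun i => (hexagonNormal a i : ℝ)) ⬝ᵥ q = -1 ∧ p 0 * q 1 - p 1 * q 0 ≠ 0) :
      ∃ p ∈ Z2, ∃ q ∈ Z2, (fun i => (hexagonNormal a i : ℝ)) ⬝ᵥ p = -1 ∧
      (fun i => (hexagonNormal a i : ℝ)) ⬝ᵥ q = -1 ∧ p 0 * q 1 - p 1 * q 0 ≠ 0 :=
    ⟨p, h.1, q, h.2.1, h.2.2⟩
  simp only [mem_Z2_iff] at key ⊢
  fin_cases a
  · exact key ![-1, 0] ![-1, -1] (by norm_num [hexagonNormal, dotProduct, Fin.sum_univ_two])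
  · exact key ![1, 0] ![1, 1] (by norm_num [hexagonNormal, dotProduct, Fin.sum_univ_two])
  · exact key ![0, -1] ![-1, -1] (by norm_num [hexagonNormal, dotProduct, Fin.sum_univ_two])
  · exact key ![0, 1] ![1, 1] (by norm_num [hexagonNormal, dotProduct, Fin.sum_univ_two])
  · exact key ![1, 0] ![0, -1] (by norm_num [hexagonNormal, dotProduct, Fin.sum_univ_two])
  · exact key ![-1, 0] ![0, 1] (by norm_num [hexagonNormal, dotProduct, Fin.sum_univ_two])

/-- A facet normal of a product of hexagons is determined by the points of its facet. -/
theorem eq_pairLift_of_tight {m : ℕ} (j : Fin m) (a : Fin 6) {η : Fin (2 * m) → ℝ}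
    (hη : ∀ x ∈ prodZ2 m, pairLift j (fun i => (hexagonNormal a i : ℝ)) ⬝ᵥ x = -1 →
      η ⬝ᵥ x = -1) :
    η = pairLift j fun i => (hexagonNormal a i : ℝ) := by
  set h : Fin 2 → ℝ := fun i => (hexagonNormal a i : ℝ) with hh
  obtain ⟨p, hp, q, hq, hpa, hqa, hpq⟩ := exists_hexagonNormal_edge a
  rw [← hh] at hpa hqa
  have hlift : ∀ x ∈ Z2, pairLift j x ∈ prodZ2 m := by
    intro x hx j'
    rw [pairCoords_pairLift]
    split_ifs
    · exact hx
    · rw [mem_Z2_iff]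
      simp
  have htight (x : Fin 2 → ℝ) : pairLift j h ⬝ᵥ pairLift j x = h ⬝ᵥ x := by
    rw [dotProduct_pairLift, pairCoords_pairLift, if_pos rfl]
  have hηp : pairCoords η j ⬝ᵥ p = -1 := by
    rw [← dotProduct_pairLift]
    exact hη _ (hlift p hp) (by rw [htight, hpa])
  have hηq : pairCoords η j ⬝ᵥ q = -1 := by
    rw [← dotProduct_pairLift]
    exact hη _ (hlift q hq) (by rw [htight, hqa])
  have hj : pairCoords η j = h := by
    simp only [dotProduct, Fin.sum_univ_two] at hpa hqa hηp hηq
    set b := pairCoords η j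
    have h₀ : b 0 - h 0 = 0 := by
      refine (mul_eq_zero.1 ?_).resolve_right hpq
      linear_combination (hηp - hpa) * q 1 - (hηq - hqa) * p 1
    have h₁ : b 1 - h 1 = 0 := by
      refine (mul_eq_zero.1 ?_).resolve_right hpq
      linear_combination (hηq - hqa) * p 0 - (hηp - hpa) * q 0
    ext i
    fin_cases i
    · exact sub_eq_zero.1 h₀
    · exact sub_eq_zero.1 h₁
  have hj' (j' : Fin m) (hne : j' ≠ j) (i : Fin 2) : pairCoords η j' i = 0 := by
    set s : Fin 2 → ℝ := Pi.single i 1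
    have hs : s ∈ Z2 := by
      rw [mem_Z2_iff]
      fin_cases i <;> simp [s]
    have hmem : pairLift j p + pairLift j' s ∈ prodZ2 m := by
      intro k
      have : pairCoords (pairLift j p + pairLift j' s) k =
          pairCoords (pairLift j p) k + pairCoords (pairLift j' s) k := rfl
      rw [this, pairCoords_pairLift, pairCoords_pairLift]
      by_cases hk : k = j
      · rw [if_pos hk, if_neg (fun hk' => hne (hk'.symm.trans hk)), add_zero]
        exact hp
      · rw [if_neg hk, zero_add]
        split_ifs
        · exact hs
        · rw [mem_Z2_iff]
          simp
    have := hη _ hmem (by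
      rw [dotProduct_add, htight, hpa, dotProduct_pairLift, pairCoords_pairLift, if_neg hne,
        zero_dotProduct, add_zero])
    rw [dotProduct_add, dotProduct_pairLift, dotProduct_pairLift, hηp] at this
    simpa [s] using this
  ext k
  obtain ⟨j', i, hk⟩ := exists_pairCoords_eq k
  rw [← hk η, ← hk (pairLift j h), pairCoords_pairLift]
  split_ifs with hjj
  · rw [hjj, hj]
  · exact hj' j' hjj i

theorem card_extremePoints_ge_of_latticeEquivTo {m : ℕ} {P : Set (Fin (2 * m) → ℝ)}
    (hc : Convex ℝ P) (hcl : IsClosed P) (h0 : (0 : Fin (2 * m) → ℝ) ∈ P)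
    (hfin : (Set.extremePoints ℝ P).Finite) (hP : LatticeEquivTo (dualPolytope P) (prodZ2 m)) :
    3 * (2 * m) ≤ (Set.extremePoints ℝ P).ncard := by
  obtain ⟨f, -, hf⟩ := hP
  let adj (g : (Fin (2 * m) → ℝ) ≃ₗ[ℝ] (Fin (2 * m) → ℝ)) (ξ : Fin (2 * m) → ℝ) :
      Fin (2 * m) → ℝ := fun i => ξ ⬝ᵥ g (Pi.single i 1)
  have hadj (g : (Fin (2 * m) → ℝ) ≃ₗ[ℝ] (Fin (2 * m) → ℝ)) (ξ y : Fin (2 * m) → ℝ) :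
      adj g ξ ⬝ᵥ y = ξ ⬝ᵥ g y := by
    let φ : (Fin (2 * m) → ℝ) →ₗ[ℝ] ℝ :=
      { toFun := fun x => ξ ⬝ᵥ g x
        map_add' := fun x y => by rw [map_add, dotProduct_add]
        map_smul' := fun c x => by rw [map_smul, dotProduct_smul]; rfl }
    rw [dotProduct_comm]
    exact (linearMap_apply_eq_dotProduct φ y).symm
  have hmem (y : Fin (2 * m) → ℝ) : y ∈ dualPolytope P ↔ f y ∈ prodZ2 m := by
    rw [← hf, f.injective.mem_set_image]
  let N (q : Fin m × Fin 6) : Fin (2 * m) → ℝ :=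
    pairLift q.1 fun i => (hexagonNormal q.2 i : ℝ)
  have hN (q : Fin m × Fin 6) (x : Fin (2 * m) → ℝ) :
      N q ⬝ᵥ x = (fun i => (hexagonNormal q.2 i : ℝ)) ⬝ᵥ pairCoords x q.1 := by
    rw [dotProduct_comm, dotProduct_pairLift, dotProduct_comm]
  have hNinj : Function.Injective N := by
    rintro ⟨j, a⟩ ⟨j', a'⟩ h
    have hpair := congrArg (fun x => pairCoords x j) h
    simp only [N, pairCoords_pairLift, if_true] at hpair
    split_ifs at hpair with hj
    · have : a = a' := hexagonNormal_injective (by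
        ext i
        exact_mod_cast congrFun hpair i)
      rw [hj, this]
    · obtain ⟨p, -, -, -, hp, -⟩ := exists_hexagonNormal_edge a
      rw [hpair, zero_dotProduct] at hp
      norm_num at hp
  have hadjinj : Function.Injective (adj f) := by
    intro ξ ξ' h
    refine dotProduct_eq _ _ fun x => ?_
    rw [← f.apply_symm_apply x, ← hadj f, ← hadj f, h]
  have hext : Set.range (adj f ∘ N) ⊆ Set.extremePoints ℝ P := by
    rintro _ ⟨q, rfl⟩
    rw [mem_extremePoints_iff_left]
    refine ⟨mem_of_forall_mem_dualPolytope hc hcl h0 fun y hy => ?_, fun A hA B hB hAB => ?_⟩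
    · rw [Function.comp_apply, hadj, hN]
      exact neg_one_le_hexagonNormal_dotProduct _ ((hmem y).1 hy q.1)
    · obtain ⟨s, t, hs, ht, hst, heq⟩ := hAB
      have hA' : adj f.symm A = N q := by
        refine eq_pairLift_of_tight q.1 q.2 fun x hx hxt => ?_
        have hy : f.symm x ∈ dualPolytope P := (hmem _).2 (by rwa [f.apply_symm_apply])
        have h₁ : -1 ≤ A ⬝ᵥ f.symm x := hy A hA
        have h₂ : -1 ≤ B ⬝ᵥ f.symm x := hy B hB
        have h₃ : (s • A + t • B) ⬝ᵥ f.symm x = -1 := by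
          rw [heq, Function.comp_apply, hadj, f.apply_symm_apply]
          exact hxt
        rw [add_dotProduct, smul_dotProduct, smul_dotProduct, smul_eq_mul, smul_eq_mul] at h₃
        rw [hadj]
        have : s * (A ⬝ᵥ f.symm x + 1) ≤ 0 := by nlinarith
        nlinarith
      refine dotProduct_eq _ _ fun y => ?_
      rw [Function.comp_apply, hadj, ← hA', hadj, f.symm_apply_apply]
  have h := Set.ncard_le_ncard hext hfin
  rw [← Set.image_univ, Set.ncard_image_of_injective _ (hadjinj.comp hNinj), Set.ncard_univ,
    Nat.card_eq_fintype_card, Fintype.card_prod, Fintype.card_fin, Fintype.card_fin] at h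
  omega

theorem IsReflexive.exists_involution {d : ℕ} {P : Set (Fin d → ℝ)} (hP : IsReflexive P)
    (hs : IsSimplicial P) (hcard : (Set.extremePoints ℝ P).ncard = 3 * d)
    (hne : (Set.extremePoints ℝ (dualPolytope P)).Nonempty) :
    ∃ (e z : Fin d → (Fin d → ℝ)) (σ : Fin d → Fin d),
      (∀ i, σ (σ i) = i) ∧ (∀ i, σ i ≠ i) ∧
      (∀ y, y = ∑ i, (e i ⬝ᵥ y) • z i) ∧
      (∀ i, IsLatticePoint (e i)) ∧ (∀ i, IsLatticePoint (z i)) ∧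
      ∀ y, y ∈ dualPolytope P ↔ ∀ i, |e i ⬝ᵥ y| ≤ 1 ∧ |e (σ i) ⬝ᵥ y - e i ⬝ᵥ y| ≤ 1 := by
  obtain ⟨V, W, hV, hW, hPV, hPW, hVlat, hWlat, H⟩ := hP.exists_pair hs
  rw [← hV, Set.ncard_coe_finset] at hcard
  rw [← hW] at hne
  obtain ⟨w, hw⟩ := hne
  have hc : Convex ℝ P := hPV ▸ convex_convexHull ℝ _
  have hcl : IsClosed P := hPV ▸ V.finite_toSet.isClosed_convexHull ℝ
  have hdualneg : ∀ y ∈ dualPolytope P, -y ∈ dualPolytope P := by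
    intro y hy
    have hsub : convexHull ℝ (W : Set (Fin d → ℝ)) ⊆ -dualPolytope P := by
      refine convexHull_min (fun w hw => ?_) (convex_dualPolytope P).neg
      rw [Set.mem_neg, hPV, mem_dualPolytope_convexHull_iff]
      intro v hv
      rw [dotProduct_neg]
      linarith [(H.level_of_card_eq hcard hw).1 v hv]
    exact hsub (hPW ▸ hy)
  have hPneg : ∀ x ∈ P, -x ∈ P := fun x hx =>
    mem_of_forall_mem_dualPolytope hc hcl (interior_subset hP.2.1) fun y hy => by
      rw [neg_dotProduct, ← dotProduct_neg]
      exact hdualneg y hy x hx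
  have hVneg : ∀ v ∈ V, -v ∈ V := by
    intro v hv
    rw [← Finset.mem_coe, hV, mem_extremePoints_iff_left] at hv ⊢
    refine ⟨hPneg v hv.1, fun a ha b hb ⟨s, t, hs, ht, hst, hab⟩ => ?_⟩
    have := hv.2 (-a) (hPneg a ha) (-b) (hPneg b hb)
      ⟨s, t, hs, ht, hst, by rw [smul_neg, smul_neg, ← neg_add, hab, neg_neg]⟩
    rw [← this, neg_neg]
  obtain ⟨e, z, σ, hσ, hσne, -, hy, hz, hVe⟩ := H.exists_involution hcard hVneg hWlat hw
  refine ⟨e, z, σ, hσ, hσne, hy, fun i => hVlat _ ((hVe _).2 ⟨i, Or.inl rfl⟩), hz, fun y => ?_⟩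
  rw [hPV, mem_dualPolytope_convexHull_iff]
  simp only [Finset.mem_coe, hVe, abs_le]
  constructor
  · intro h i
    have h₁ := h _ ⟨i, Or.inl rfl⟩
    have h₂ := h _ ⟨i, Or.inr (Or.inl rfl)⟩
    have h₃ := h _ ⟨i, Or.inr (Or.inr rfl)⟩
    have h₄ := h _ ⟨σ i, Or.inr (Or.inr rfl)⟩
    rw [neg_dotProduct] at h₂
    rw [sub_dotProduct] at h₃ h₄
    rw [hσ] at h₄
    exact ⟨⟨h₁, by linarith⟩, h₃, by linarith⟩
  · rintro h v ⟨i, rfl | rfl | rfl⟩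
    · exact (h i).1.1
    · rw [neg_dotProduct]
      linarith [(h i).1.2]
    · rw [sub_dotProduct]
      exact (h i).2.1

/-- If `P` is a simplicial reflexive polytope whose dual has a vertex `u` with
`-u ∈ P*`, then `|V(P)| ≤ 3d` for `d` even and `|V(P)| ≤ 3d - 1` for `d` odd; for `d` even,
equality `|V(P)| = 3d` holds iff `P*` is unimodularly equivalent to the `(d/2)`-fold product
`Z₂ × ⋯ × Z₂`. -/
theorem symmetric_vertex_bound {d : ℕ} (P : Set (Fin d → ℝ)) (hP : IsReflexive P)
    (hs : IsSimplicial P) (u : Fin d → ℝ)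
    (hu : u ∈ Set.extremePoints ℝ (dualPolytope P)) (hmu : -u ∈ dualPolytope P) :
    (Even d → (Set.extremePoints ℝ P).ncard ≤ 3 * d) ∧
    (Odd d → (Set.extremePoints ℝ P).ncard ≤ 3 * d - 1) ∧
    (∀ m : ℕ, d = 2 * m →
      ((Set.extremePoints ℝ P).ncard = 3 * d ↔
        LatticeEquivTo (dualPolytope P) (prodZ2 m))) := by
  obtain ⟨V, W, hV, hW, hPV, hPW, hVlat, hWlat, H⟩ := hP.exists_pair hs
  have hle : (Set.extremePoints ℝ P).ncard ≤ 3 * d := by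
    rw [← hV, Set.ncard_coe_finset]
    refine H.card_le_of_le_one (u := u) (by rwa [← Finset.mem_coe, hW]) fun v hv => ?_
    have hvP : v ∈ P := extremePoints_subset (hV ▸ hv : v ∈ Set.extremePoints ℝ P)
    have h : -1 ≤ v ⬝ᵥ -u := hmu v hvP
    rw [dotProduct_neg] at h
    linarith
  refine ⟨fun _ => hle, fun hodd => ?_, ?_⟩
  · rcases hle.lt_or_eq with h | h
    · omega
    · obtain ⟨e, z, σ, hσ, hσne, -⟩ := hP.exists_involution hs h ⟨u, hu⟩
      obtain ⟨m, -, hm, -⟩ := exists_pairing_of_involution hσ hσne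
      rw [hm] at hodd
      exact absurd (even_two_mul m) (Nat.not_even_iff_odd.2 hodd)
  · rintro m rfl
    refine ⟨fun h => ?_, fun h => hle.antisymm ?_⟩
    · obtain ⟨e, z, σ, hσ, hσne, hy, he, hz, hQ⟩ := hP.exists_involution hs h ⟨u, hu⟩
      exact latticeEquivTo_prodZ2 hσ hσne hy he hz hQ
    · exact card_extremePoints_ge_of_latticeEquivTo (hPV ▸ convex_convexHull ℝ _)
        (hPV ▸ V.finite_toSet.isClosed_convexHull ℝ) (interior_subset hP.2.1)
        (hV ▸ V.finite_toSet) h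

end
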